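/- Let α, m, n ∈ ℕ₀ with α ≤ m ≤ n, and let x, y be real numbers with x ≠ y. Then the Christoffel–Darboux type identity holds: Σ_{l=m}^n p_{l−α}^{(α)}(x) · p_{l−m}^{(α)}(y, m−α) = p_{m−α−1}^{(α)}(x)/(x−y) + b_{n−α+1}^{(α)} · [p_{n−α+1}^{(α)}(x) p_{n−m}^{(α)}(y, m−α) − p_{n−α}^{(α)}(x) p_{n−m+1}^{(α)}(y, m−α)]/(x−y). -/

import Mathlib

open MeasureTheory Finset

noncomputable section

namespace SFT

/-- The recurrence coefficients `b_l^{(α)}` of the orthonormal ultraspherical polynomials. -/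
def b (α : ℝ) : ℕ → ℝ
  | 0 => Real.sqrt (Real.sqrt Real.pi * Real.Gamma (α + 1) / (2 * Real.Gamma (α + 3 / 2)))
  | l + 1 => Real.sqrt ((((l : ℝ) + 1) * (((l : ℝ) + 1) + 2 * α)) /
      ((2 * ((l : ℝ) + 1) + 2 * α + 1) * (2 * ((l : ℝ) + 1) + 2 * α - 1)))

/-- The associated ultraspherical polynomials: `pA α m l x = p_l^{(α)}(x, m)`.
For `m = 0` these are the orthonormal ultraspherical polynomials `p_l^{(α)}(x)`. -/
def pA (α : ℝ) (m : ℕ) : ℕ → ℝ → ℝ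
  | 0, _ => 1 / b α m
  | 1, x => x * (1 / b α m) / b α (m + 1)
  | l + 2, x => (x * pA α m (l + 1) x - b α (m + l + 1) * pA α m l x) / b α (m + l + 2)

/-- The orthonormal ultraspherical polynomials `p_l^{(α)}(x)`. -/
def p (α : ℝ) (l : ℕ) (x : ℝ) : ℝ := pA α 0 l x

/-- Ultraspherical polynomials with integer index; in particular `p_{-1}^{(α)} = 0`. -/
def pZ (α : ℝ) (l : ℤ) (x : ℝ) : ℝ := if 0 ≤ l then p α l.toNat x else 0

/-- `JE α M i j` is the `(i,j)` entry (`0`-based) of the truncated Jacobi matrix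
`J(α)_L^M` (of any size `L − M + 1`). -/
def JE (α : ℝ) (M : ℕ) (i j : ℕ) : ℝ :=
  if i + 1 = j then b α (M + i + 1) else if j + 1 = i then b α (M + j + 1) else 0

/-- The truncated Jacobi matrix `J(α)_{M+l}^M`, of size `(l+1) × (l+1)`.
In particular `Jt α 0 l` is the Jacobi matrix `J(α)_l`. -/
def Jt (α : ℝ) (M l : ℕ) : Matrix (Fin (l + 1)) (Fin (l + 1)) ℝ :=
  fun i j => JE α M i.1 j.1

/-- The spherical harmonics `Y_l^k(θ, φ)`. -/
def Y (l : ℕ) (k : ℤ) (θ φ : ℝ) : ℂ :=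
  ((Real.sin θ ^ k.natAbs : ℝ) : ℂ) * ((p (k.natAbs : ℝ) (l - k.natAbs) (Real.cos θ) : ℝ) : ℂ) *
    Complex.exp (Complex.I * (k : ℂ) * (φ : ℂ))

/-- Parameter region `[0, π] × [0, 2π]` of spherical coordinates. -/
def region : Set (ℝ × ℝ) := Set.Icc (0 : ℝ) Real.pi ×ˢ Set.Icc (0 : ℝ) (2 * Real.pi)

/-- The inner product of `L²(S²)`. -/
def inner2 (f g : ℝ → ℝ → ℂ) : ℂ :=
  (1 / (4 * Real.pi)) *
    ∫ q in region, f q.1 q.2 * (starRingEnd ℂ) (g q.1 q.2) * ((Real.sin q.1 : ℝ) : ℂ)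

/-- The norm of `L²(S²)`. -/
def norm2 (f : ℝ → ℝ → ℂ) : ℝ := Real.sqrt (inner2 f f).re

/-- Membership in `L²(S²)`. -/
def MemL2 (f : ℝ → ℝ → ℂ) : Prop :=
  Measurable (fun q : ℝ × ℝ => f q.1 q.2) ∧
    IntegrableOn (fun q : ℝ × ℝ => ‖f q.1 q.2‖ ^ 2 * Real.sin q.1) region

/-- The multiplication operator `M`. -/
def Mop (f : ℝ → ℝ → ℂ) : ℝ → ℝ → ℂ := fun θ φ => ((Real.cos θ : ℝ) : ℂ) * f θ φ

/-- The power `M^j` of the multiplication operator. -/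
def Mpow (j : ℕ) (f : ℝ → ℝ → ℂ) : ℝ → ℝ → ℂ := fun θ φ => ((Real.cos θ : ℝ) : ℂ) ^ j * f θ φ

/-- The mean value `ε(f)`. -/
def eps (f : ℝ → ℝ → ℂ) : ℝ :=
  (1 / (4 * Real.pi)) * ∫ q in region, Real.cos q.1 * ‖f q.1 q.2‖ ^ 2 * Real.sin q.1

/-- The projection `P_n^m` onto `Π_n^m`. -/
def Pr (n m : ℕ) (f : ℝ → ℝ → ℂ) : ℝ → ℝ → ℂ :=
  fun θ φ => ∑ l ∈ Finset.Icc m n, ∑ k ∈ Finset.Icc (-(l : ℤ)) (l : ℤ),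
    inner2 f (Y l k) * Y l k θ φ

/-- The space–frequency operator `P_n^m M P_n^m`. -/
def SFop (n m : ℕ) (f : ℝ → ℝ → ℂ) : ℝ → ℝ → ℂ := Pr n m (Mop (Pr n m f))

/-- The space `Π_n^m`, spanned by the spherical harmonics `Y_l^k`, `m ≤ l ≤ n`, `|k| ≤ l`. -/
def Pi_nm (n m : ℕ) : Submodule ℂ (ℝ → ℝ → ℂ) :=
  Submodule.span ℂ {g | ∃ l : ℕ, ∃ k : ℤ, m ≤ l ∧ l ≤ n ∧ k.natAbs ≤ l ∧ g = Y l k}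

/-- `N_k = n − max(|k|, m) + 1`. -/
def Nk (n m k : ℕ) : ℕ := n - max k m + 1

/-- The normalizing constant `κ_{k,i}`, given the corresponding root value `xr`. -/
def kap (n m k : ℕ) (xr : ℝ) : ℝ :=
  (Real.sqrt (∑ l ∈ Finset.Icc (max k m) n, (pA (k : ℝ) (m - k) (l - max k m) xr) ^ 2))⁻¹

/-- The eigenfunction `ψ_{k,i}`, given the corresponding root value `xr`. -/
def psiFun (n m : ℕ) (k : ℤ) (xr : ℝ) : ℝ → ℝ → ℂ :=
  fun θ φ => ((kap n m k.natAbs xr : ℝ) : ℂ) *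
    ∑ l ∈ Finset.Icc (max k.natAbs m) n,
      ((pA (k.natAbs : ℝ) (m - k.natAbs) (l - max k.natAbs m) xr : ℝ) : ℂ) * Y l k θ φ

theorem b_pos (α : ℕ) (l : ℕ) : 0 < b (α : ℝ) l := by
  have ha : (0 : ℝ) ≤ α := Nat.cast_nonneg α
  cases l with
  | zero =>
    unfold b
    have h1 : 0 < Real.Gamma ((α : ℝ) + 1) := Real.Gamma_pos_of_pos (by linarith)
    have h2 : 0 < Real.Gamma ((α : ℝ) + 3 / 2) := Real.Gamma_pos_of_pos (by linarith)
    have h3 := Real.pi_pos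
    positivity
  | succ l =>
    unfold b
    have hl : (0 : ℝ) ≤ l := Nat.cast_nonneg l
    apply Real.sqrt_pos.mpr
    apply div_pos
    · positivity
    · apply mul_pos <;> linarith

theorem pA_rec (α M l : ℕ) (x : ℝ) :
    b (α : ℝ) (M + l + 2) * pA (α : ℝ) M (l + 2) x =
      x * pA (α : ℝ) M (l + 1) x - b (α : ℝ) (M + l + 1) * pA (α : ℝ) M l x := by
  rw [pA]
  exact mul_div_cancel₀ _ (b_pos α _).ne'

theorem pA_one (α M : ℕ) (x : ℝ) :
    b (α : ℝ) (M + 1) * pA (α : ℝ) M 1 x = x * pA (α : ℝ) M 0 x := by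
  rw [pA, pA]
  exact mul_div_cancel₀ _ (b_pos α _).ne'

theorem p_rec (α M : ℕ) (x : ℝ) :
    b (α : ℝ) (M + 1) * p (α : ℝ) (M + 1) x =
      x * p (α : ℝ) M x - b (α : ℝ) M * pZ (α : ℝ) ((M : ℤ) - 1) x := by
  cases M with
  | zero =>
    have := pA_one α 0 x
    simpa [p, pZ] using this
  | succ M =>
    have := pA_rec α 0 M x
    simpa [p, pZ] using this

theorem cd_aux (α M k : ℕ) (x y : ℝ) :
    (x - y) * ∑ j ∈ Finset.range (k + 1), p (α : ℝ) (M + j) x * pA (α : ℝ) M j y =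
      pZ (α : ℝ) ((M : ℤ) - 1) x +
      b (α : ℝ) (M + k + 1) *
        (p (α : ℝ) (M + k + 1) x * pA (α : ℝ) M k y -
          p (α : ℝ) (M + k) x * pA (α : ℝ) M (k + 1) y) := by
  induction k with
  | zero =>
    have h1 := p_rec α M x
    have h2 := pA_one α M y
    have h3 : b (α : ℝ) M * pA (α : ℝ) M 0 y = 1 := by
      rw [pA]
      exact mul_one_div_cancel (b_pos α _).ne'
    simp only [zero_add, Finset.sum_range_one, add_zero]
    linear_combination (-pA (α : ℝ) M 0 y) * h1 + p (α : ℝ) M x * h2 +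
      pZ (α : ℝ) ((M : ℤ) - 1) x * h3
  | succ k ih =>
    rw [Finset.sum_range_succ, mul_add, ih]
    have h1 := p_rec α (M + k + 1) x
    have h2 := pA_rec α M k y
    have h4 : pZ (α : ℝ) (((M + k + 1 : ℕ) : ℤ) - 1) x = p (α : ℝ) (M + k) x := by
      have e : ((M + k + 1 : ℕ) : ℤ) - 1 = ((M + k : ℕ) : ℤ) := by push_cast; ring
      rw [e, pZ, if_pos (Int.natCast_nonneg _), Int.toNat_natCast]
    rw [h4] at h1
    simp only [← add_assoc] at *
    linear_combination (-pA (α : ℝ) M (k + 1) y) * h1 + p (α : ℝ) (M + k + 1) x * h2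

/-- the Christoffel–Darboux type identity. -/
theorem stmt3 (α m n : ℕ) (h1 : α ≤ m) (h2 : m ≤ n) (x y : ℝ) (hxy : x ≠ y) :
    ∑ l ∈ Finset.Icc m n, p (α : ℝ) (l - α) x * pA (α : ℝ) (m - α) (l - m) y =
      pZ (α : ℝ) ((m : ℤ) - (α : ℤ) - 1) x / (x - y) +
      b (α : ℝ) (n - α + 1) *
        (p (α : ℝ) (n - α + 1) x * pA (α : ℝ) (m - α) (n - m) y -
          p (α : ℝ) (n - α) x * pA (α : ℝ) (m - α) (n - m + 1) y) / (x - y) := by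
  obtain ⟨M, rfl⟩ := Nat.exists_eq_add_of_le h1
  obtain ⟨k, rfl⟩ := Nat.exists_eq_add_of_le h2
  have hd : x - y ≠ 0 := sub_ne_zero.mpr hxy
  have key := cd_aux α M k x y
  have e1 : α + M - α = M := by omega
  have e2 : α + M + k - α = M + k := by omega
  have e3 : α + M + k - (α + M) = k := by omega
  have e4 : ((α + M : ℕ) : ℤ) - (α : ℤ) - 1 = (M : ℤ) - 1 := by push_cast; ring
  have hs : ∑ l ∈ Finset.Icc (α + M) (α + M + k),
      p (α : ℝ) (l - α) x * pA (α : ℝ) M (l - (α + M)) y =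
      ∑ j ∈ Finset.range (k + 1), p (α : ℝ) (M + j) x * pA (α : ℝ) M j y := by
    rw [← Finset.Ico_add_one_right_eq_Icc, Finset.sum_Ico_eq_sum_range]
    have e5 : α + M + k + 1 - (α + M) = k + 1 := by omega
    rw [e5]
    refine Finset.sum_congr rfl fun j _ => ?_
    have e6 : α + M + j - α = M + j := by omega
    have e7 : α + M + j - (α + M) = j := by omega
    rw [e6, e7]
  rw [e1, e2, e3, e4, hs, ← add_div, eq_div_iff hd, mul_comm, key]
end SFT
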